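/- arXiv:1912.07147 — 2 statements merged into one kernel-verified Lean document; each statement's English description precedes it below -/
import Mathlib

section
/- Let r ∈ {3,4} and n ≥ 18. If G is a 2-connected graph on n vertices with rc₂(G) ≤ r, then |E(G)| ≥ (4/3)·n − 24. Consequently t₂(n,r) ≥ (4/3)·n − 24. -/
open SimpleGraph

/-- A walk is rainbow (w.r.t. an edge-colouring `col`) if its edges receive
pairwise distinct colours. -/
def IsRainbowWalk {V α : Type*} {G : SimpleGraph V} {u v : V} (col : Sym2 V → α)
    (p : G.Walk u v) : Prop :=
  (p.edges.map col).Nodup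

/-- An edge-colouring is rainbow 2-connected if every two distinct vertices are
connected by two internally vertex-disjoint rainbow paths. -/
def RainbowTwoConnectedColouring {V α : Type*} (G : SimpleGraph V) (col : Sym2 V → α) : Prop :=
  ∀ u v : V, u ≠ v → ∃ p q : G.Walk u v, p.IsPath ∧ q.IsPath ∧ p ≠ q ∧
    IsRainbowWalk col p ∧ IsRainbowWalk col q ∧
    ∀ w : V, w ∈ p.support → w ∈ q.support → w = u ∨ w = v

/-- The rainbow 2-connection number: the least number of colours in a rainbow
2-connected colouring. -/
noncomputable def rc2 {V : Type*} (G : SimpleGraph V) : ℕ :=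
  sInf {r : ℕ | ∃ col : Sym2 V → Fin r, RainbowTwoConnectedColouring G col}

/-- A graph is 2-connected if it has at least 3 vertices and deleting any single
vertex leaves a connected graph. -/
def TwoConnected {V : Type*} [Fintype V] (G : SimpleGraph V) : Prop :=
  3 ≤ Fintype.card V ∧ ∀ v : V, (G.induce ({v}ᶜ : Set V)).Connected

/-- `t2 n r`: minimum number of edges of a 2-connected graph on `n` vertices
with rainbow 2-connection number at most `r`. -/
noncomputable def t2 (n r : ℕ) : ℕ :=
  sInf {m : ℕ | ∃ G : SimpleGraph (Fin n), TwoConnected G ∧ rc2 G ≤ r ∧ G.edgeSet.ncard = m}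

/-- `s2 n r`: maximum number of edges of a 2-connected graph on `n` vertices
with rainbow 2-connection number at least `r`. -/
noncomputable def s2 (n r : ℕ) : ℕ :=
  sSup {m : ℕ | ∃ G : SimpleGraph (Fin n), TwoConnected G ∧ r ≤ rc2 G ∧ G.edgeSet.ncard = m}

namespace SimpleGraph

section Whitney

variable {V : Type*} {G : SimpleGraph V}

/-- Two internally disjoint paths from `u` to `v`, the second of which avoids the edge `uv`. -/
def HasDisjointPaths (G : SimpleGraph V) (u v : V) : Prop :=
  ∃ p q : G.Walk u v, p.IsPath ∧ q.IsPath ∧ s(u, v) ∉ q.edges ∧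
    ∀ w, w ∈ p.support → w ∈ q.support → w = u ∨ w = v

theorem HasDisjointPaths.of_walks {u v : V} (p q : G.Walk u v) (he : s(u, v) ∉ q.edges)
    (hd : ∀ w, w ∈ p.support → w ∈ q.support → w = u ∨ w = v) : G.HasDisjointPaths u v := by
  classical
  exact ⟨p.bypass, q.bypass, p.bypass_isPath, q.bypass_isPath,
    fun h => he (q.edges_bypass_subset_edges h),
    fun w h1 h2 => hd w (p.support_bypass_subset_support h1) (q.support_bypass_subset_support h2)⟩

/-- A walk that ends in `S` has a first vertex in `S`. -/
theorem Walk.exists_walk_to_first (S : Set V) {v u : V} (p : G.Walk v u) (hu : u ∈ S) :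
    ∃ x ∈ S, ∃ q : G.Walk v x, q.support ⊆ p.support ∧ ∀ y ∈ q.support, y ∈ S → y = x := by
  induction p with
  | nil => exact ⟨_, hu, .nil, by simp, by simp⟩
  | @cons v w u h p ih =>
    by_cases hv : v ∈ S
    · exact ⟨v, hv, .nil, by simp, by simp⟩
    · obtain ⟨x, hx, q, hq, hS⟩ := ih hu
      refine ⟨x, hx, .cons h q, ?_, ?_⟩
      · simp only [Walk.support_cons]
        exact List.cons_subset_cons _ hq
      · intro y hy hyS
        rw [Walk.support_cons, List.mem_cons] at hy
        rcases hy with rfl | hy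
        · exact absurd hyS hv
        · exact hS y hy hyS

/-- Rerouting one of two disjoint paths along an ear. -/
theorem HasDisjointPaths.extend {u v w x : V} (huv : u ≠ v) (hwu : w ≠ u) (h : G.Adj w v)
    {p q : G.Walk u w} (hp : p.IsPath)
    (hd : ∀ y, y ∈ p.support → y ∈ q.support → y = u ∨ y = w)
    (hx : x ∈ p.support) (r : G.Walk v x) (hw : w ∉ r.support)
    (hr : ∀ y ∈ r.support, y ∈ p.support ∨ y ∈ q.support → y = x) :
    G.HasDisjointPaths u v := by
  classical
  have hxw : x ≠ w := fun e => hw (e ▸ r.end_mem_support)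
  have hvq : v ∉ q.support := fun hv => by
    have e := hr v r.start_mem_support (.inr hv)
    rcases hd v (e ▸ hx) hv with e | e
    · exact huv e.symm
    · exact h.ne e.symm
  refine .of_walks ((p.takeUntil x hx).append r.reverse) (q.concat h) ?_ ?_
  · rw [Walk.edges_concat, List.concat_eq_append, List.mem_append, List.mem_singleton]
    rintro (he | he)
    · exact hvq (q.snd_mem_support_of_mem_edges he)
    · rcases Sym2.eq_iff.1 he with ⟨e, -⟩ | ⟨e, -⟩
      · exact hwu e.symm
      · exact huv e
  · intro y h1 h2
    rw [Walk.support_concat, List.mem_append, List.mem_singleton] at h2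
    rcases h2 with h2 | h2
    · rw [Walk.mem_support_append_iff, Walk.support_reverse, List.mem_reverse] at h1
      rcases h1 with h1 | h1
      · rcases hd y (p.support_takeUntil_subset_support hx h1) h2 with e | e
        · exact .inl e
        · subst e
          exact absurd h1 (Walk.endpoint_notMem_support_takeUntil hp hx hxw.symm)
      · have e := hr y h1 (.inr h2)
        subst e
        rcases hd y hx h2 with e | e
        · exact .inl e
        · exact absurd e hxw
    · exact .inr h2

end Whitney

end SimpleGraph

theorem TwoConnected.exists_walk_avoiding {V : Type*} [Fintype V] {G : SimpleGraph V}
    (hG : TwoConnected G) {x y z : V} (hx : x ≠ z) (hy : y ≠ z) :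
    ∃ p : G.Walk x y, z ∉ p.support := by
  obtain ⟨p⟩ := (hG.2 z).preconnected ⟨x, by simpa using hx⟩ ⟨y, by simpa using hy⟩
  suffices h : z ∉ (p.map (SimpleGraph.Embedding.induce _).toHom).support from ⟨_, h⟩
  rw [Walk.support_map, List.mem_map]
  rintro ⟨⟨t, ht⟩, -, htz⟩
  exact ht htz

theorem TwoConnected.exists_third {V : Type*} [Fintype V] {G : SimpleGraph V}
    (hG : TwoConnected G) (u v : V) : ∃ t, t ≠ u ∧ t ≠ v := by
  classical
  by_contra! h
  have h3 : Fintype.card V ≤ ({u, v} : Finset V).card :=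
    Finset.card_le_card fun t _ => by
      by_cases e : t = u
      · simp [e]
      · simp [h t e]
  have := Finset.card_le_two (a := u) (b := v)
  have := hG.1
  omega

/-- Whitney's theorem. -/
theorem TwoConnected.hasDisjointPaths {V : Type*} [Fintype V] {G : SimpleGraph V}
    (hG : TwoConnected G) {u v : V} (huv : u ≠ v) : G.HasDisjointPaths u v := by
  obtain ⟨p⟩ : G.Reachable v u := by
    obtain ⟨t, htu, htv⟩ := hG.exists_third u v
    exact (hG.exists_walk_avoiding htv.symm htu.symm).elim fun p _ => ⟨p⟩
  induction p with
  | nil => exact absurd rfl huv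
  | @cons v w u h p ih =>
    by_cases hwu : w = u
    · subst hwu
      obtain ⟨t, htu, htv⟩ := hG.exists_third w v
      obtain ⟨a, ha⟩ := hG.exists_walk_avoiding huv htv
      obtain ⟨b, hb⟩ := hG.exists_walk_avoiding htu huv.symm
      refine .of_walks h.symm.toWalk (a.append b) ?_ (by simp)
      rw [Walk.edges_append, List.mem_append]
      rintro (he | he)
      · exact ha (a.snd_mem_support_of_mem_edges he)
      · exact hb (b.fst_mem_support_of_mem_edges he)
    · obtain ⟨p, q, hp, hq, -, hd⟩ := ih (Ne.symm hwu)
      obtain ⟨r, hr⟩ := hG.exists_walk_avoiding h.ne (Ne.symm hwu)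
      obtain ⟨x, hx, r', hr', hx'⟩ :=
        r.exists_walk_to_first {y | y ∈ p.support ∨ y ∈ q.support} (.inl p.start_mem_support)
      rcases hx with hx | hx
      · exact .extend huv hwu h.symm hp hd hx r' (fun e => hr (hr' e)) hx'
      · exact .extend huv hwu h.symm hq (fun y h1 h2 => hd y h2 h1) hx r' (fun e => hr (hr' e))
          fun y hy hS => hx' y hy hS.symm

/-- Colouring the edges of a 2-connected graph injectively is rainbow 2-connected. -/
theorem TwoConnected.exists_colouring {V : Type*} [Fintype V] {G : SimpleGraph V}
    (hG : TwoConnected G) :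
    ∃ r, ∃ col : Sym2 V → Fin r, RainbowTwoConnectedColouring G col := by
  classical
  refine ⟨_, Fintype.equivFin (Sym2 V), fun u v huv => ?_⟩
  obtain ⟨p, q, hp, hq, he, hd⟩ := hG.hasDisjointPaths huv
  refine ⟨p, q, hp, hq, ?_, hp.isTrail.edges_nodup.map (Equiv.injective _),
    hq.isTrail.edges_nodup.map (Equiv.injective _), hd⟩
  rintro rfl
  cases p with
  | nil => exact huv rfl
  | @cons _ w _ h p =>
    rcases hd w (by simp) (by simp) with e | e
    · exact h.ne e.symm
    · subst e
      simp at he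

theorem TwoConnected.exists_colouring_of_rc2_le {V : Type*} [Fintype V] {G : SimpleGraph V}
    (hG : TwoConnected G) {r : ℕ} (h : rc2 G ≤ r) :
    ∃ col : Sym2 V → Fin r, RainbowTwoConnectedColouring G col := by
  obtain ⟨col, hcol⟩ : ∃ col : Sym2 V → Fin (rc2 G), RainbowTwoConnectedColouring G col :=
    Nat.sInf_mem hG.exists_colouring
  refine ⟨Fin.castLE h ∘ col, fun u v huv => ?_⟩
  obtain ⟨p, q, hp, hq, hne, hp', hq', hd⟩ := hcol u v huv
  refine ⟨p, q, hp, hq, hne, ?_, ?_, hd⟩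
  · rw [IsRainbowWalk, ← List.map_map]
    exact List.Nodup.map (Fin.castLE_injective h) hp'
  · rw [IsRainbowWalk, ← List.map_map]
    exact List.Nodup.map (Fin.castLE_injective h) hq'

section CompleteGraph

theorem twoConnected_top {V : Type*} [Fintype V] (h : 3 ≤ Fintype.card V) :
    TwoConnected (⊤ : SimpleGraph V) := by
  classical
  refine ⟨h, fun v => ?_⟩
  obtain ⟨w, hw⟩ := Fintype.exists_ne_of_one_lt_card (by omega : 1 < Fintype.card V) v
  have : Nonempty ({v}ᶜ : Set V) := ⟨⟨w, by simpa using hw⟩⟩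
  rw [SimpleGraph.induce_top]
  exact connected_top

/-- The edge `ij` receives colour `i + j` modulo 3. -/
def sumColouring (n : ℕ) : Sym2 (Fin n) → Fin 3 :=
  Sym2.lift ⟨fun i j => Fin.ofNat 3 i + Fin.ofNat 3 j, fun _ _ => add_comm _ _⟩

theorem rainbowTwoConnectedColouring_sumColouring {n : ℕ} (hn : 3 ≤ n) :
    RainbowTwoConnectedColouring (⊤ : SimpleGraph (Fin n)) (sumColouring n) := by
  intro u v huv
  have hc : ∀ s : Fin 3, ∃ a : Fin n, Fin.ofNat 3 a = s := fun s =>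
    ⟨⟨s, by omega⟩, by simp⟩
  by_cases hs : Fin.ofNat 3 u = Fin.ofNat 3 v
  · obtain ⟨a, ha⟩ := hc (Fin.ofNat 3 u + 1)
    obtain ⟨b, hb⟩ := hc (Fin.ofNat 3 u + 2)
    have hne : ∀ {x y : Fin n}, Fin.ofNat 3 x ≠ Fin.ofNat 3 y → x ≠ y := fun h e => h (e ▸ rfl)
    have hd : ∀ t : Fin 3, t ≠ t + 1 ∧ t ≠ t + 2 ∧ t + 1 ≠ t + 2 := by decide
    have hua : u ≠ a := hne (ha ▸ (hd _).1)
    have hub : u ≠ b := hne (hb ▸ (hd _).2.1)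
    have hva : v ≠ a := hne (by rw [ha, ← hs]; exact (hd _).1)
    have hvb : v ≠ b := hne (by rw [hb, ← hs]; exact (hd _).2.1)
    have hab : a ≠ b := hne (by rw [ha, hb]; exact (hd _).2.2)
    refine ⟨.cons huv .nil, .cons hua (.cons hab (.cons hvb.symm .nil)), ?_, ?_, by simp [hva],
      ?_, ?_, ?_⟩
    · simp [huv]
    · simp [hua, hub, hab, huv, hva.symm, hvb.symm]
    · simp [IsRainbowWalk]
    · simp only [IsRainbowWalk, sumColouring, Walk.edges_cons, Walk.edges_nil, List.map_cons,
        List.map_nil, Sym2.lift_mk, ha, hb, ← hs]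
      generalize Fin.ofNat 3 u = t
      decide +revert
    · simp +contextual
  · obtain ⟨w, hw⟩ : ∃ w, w ∉ ({u, v} : Finset (Fin n)) := by
      by_contra! h
      have := Finset.card_le_card (fun t _ => h t : Finset.univ ⊆ ({u, v} : Finset (Fin n)))
      have := Finset.card_le_two (a := u) (b := v)
      simp at *
      omega
    simp only [Finset.mem_insert, Finset.mem_singleton, not_or] at hw
    refine ⟨.cons huv .nil, .cons (Ne.symm hw.1) (.cons hw.2 .nil), ?_, ?_,
      by simp [Ne.symm hw.2], ?_, ?_, ?_⟩
    · simp [huv]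
    · simp [huv, hw.2, Ne.symm hw.1]
    · simp [IsRainbowWalk]
    · simp only [IsRainbowWalk, sumColouring, Walk.edges_cons, Walk.edges_nil, List.map_cons,
        List.map_nil, Sym2.lift_mk]
      rw [add_comm (Fin.ofNat 3 w)]
      simpa using hs
    · simp +contextual

theorem rc2_top_le {n : ℕ} (hn : 3 ≤ n) : rc2 (⊤ : SimpleGraph (Fin n)) ≤ 3 :=
  Nat.sInf_le ⟨_, rainbowTwoConnectedColouring_sumColouring hn⟩

end CompleteGraph

section Discharging

variable {V : Type*} {G : SimpleGraph V}

/-- If every edge distributes at most `c` units among its ends, then at most `c * |E(G)|` units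
are distributed in total. -/
theorem SimpleGraph.sum_weight_le_mul_card_edgeFinset [Fintype V]
    [DecidableRel G.Adj] {w : V → V → ℕ} {c : ℕ} (h : ∀ x y, w x y + w y x ≤ c) :
    ∑ x, ∑ y ∈ G.neighborFinset x, w x y ≤ c * G.edgeFinset.card := by
  have hswap : ∑ x, ∑ y ∈ G.neighborFinset x, w x y = ∑ x, ∑ y ∈ G.neighborFinset x, w y x :=
    Finset.sum_comm' (by simp [G.adj_comm])
  have hle : ∑ x, ∑ y ∈ G.neighborFinset x, (w x y + w y x) ≤ ∑ x, G.degree x * c :=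
    Finset.sum_le_sum fun x _ => by
      simpa only [smul_eq_mul, G.card_neighborFinset_eq_degree] using
        Finset.sum_le_card_nsmul (G.neighborFinset x) _ c fun y _ => h x y
  simp only [Finset.sum_add_distrib] at hle
  rw [← hswap, ← Finset.sum_mul, G.sum_degrees_eq_twice_card_edges] at hle
  linarith

/-- `z` is the first internal vertex of a path of length 2 or 3 from `u` to `a` whose internal
vertices lie outside `S`. -/
def SimpleGraph.IsRouteStep (G : SimpleGraph V) (S : Set V) (a u z : V) : Prop :=
  z ∉ S ∧ G.Adj u z ∧ (G.Adj z a ∨ ∃ x ∉ S, x ≠ u ∧ G.Adj z x ∧ G.Adj x a)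

/-- A short path from `a` to `u` either is an edge or starts, seen from `u`, with a step. -/
theorem SimpleGraph.Walk.IsPath.adj_or_isRouteStep {S : Set V} {a u : V} {p : G.Walk a u}
    (hp : p.IsPath) (hl : p.length ≤ 3) (hua : u ≠ a) (hS : ∀ x ∈ p.support, x ∈ S → x = a) :
    G.Adj u a ∨ ∃ z ∈ p.support, z ≠ u ∧ G.IsRouteStep S a u z := by
  match p with
  | .nil => exact absurd rfl hua
  | .cons h .nil => exact .inl h.symm
  | .cons (v := x) h (.cons h' .nil) =>
    simp only [Walk.support_cons, Walk.support_nil, List.mem_cons, List.not_mem_nil, or_false,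
      Walk.cons_isPath_iff, not_or] at hp hS ⊢
    exact .inr ⟨x, by simp, h'.ne, fun hx => h.ne (hS x (by simp) hx).symm, h'.symm, .inl h.symm⟩
  | .cons (v := x) h (.cons (v := z) h' (.cons h'' .nil)) =>
    simp only [Walk.support_cons, Walk.support_nil, List.mem_cons, List.not_mem_nil, or_false,
      Walk.cons_isPath_iff, not_or] at hp hS ⊢
    exact .inr ⟨z, by simp, h''.ne, fun hz => hp.2.2.1 (hS z (by simp) hz).symm, h''.symm,
      .inr ⟨x, fun hx => h.ne (hS x (by simp) hx).symm, hp.1.2.2, h'.symm, h.symm⟩⟩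
  | .cons _ (.cons _ (.cons _ (.cons _ _))) => simp at hl; omega

/-- Every vertex outside `S` has internally disjoint short paths to `a` and `b`. -/
def SimpleGraph.HasRoutes (G : SimpleGraph V) (S : Set V) (a b : V) : Prop :=
  ∀ u ∉ S, (G.Adj u a ∨ ∃ z, G.IsRouteStep S a u z) ∧ (G.Adj u b ∨ ∃ z, G.IsRouteStep S b u z) ∧
    (¬ G.Adj u a → ¬ G.Adj u b →
      ∃ z z', z ≠ z' ∧ G.IsRouteStep S a u z ∧ G.IsRouteStep S b u z')

theorem SimpleGraph.HasRoutes.symm {S : Set V} {a b : V} (h : G.HasRoutes S a b) :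
    G.HasRoutes S b a := fun u hu =>
  ⟨(h u hu).2.1, (h u hu).1, fun hb ha =>
    let ⟨z, z', hne, hz, hz'⟩ := (h u hu).2.2 ha hb
    ⟨z', z, hne.symm, hz', hz⟩⟩

open Classical in
/-- The neighbours of `u` outside `S` that are adjacent to `a` or `b`. -/
noncomputable def SimpleGraph.hubNeighbors [Fintype V] (G : SimpleGraph V) (S : Set V) (a b u : V) :
    Finset V :=
  {y | G.Adj u y ∧ y ∉ S ∧ (G.Adj y a ∨ G.Adj y b)}

open Classical in
/-- The vertices of `S` have class 0, the other neighbours of `a` and `b` class 1; the remaining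
vertices have class 2, 3 or 4 if they have at least two, one or no neighbours of class 1. -/
noncomputable def SimpleGraph.routeClass [Fintype V] (G : SimpleGraph V) (S : Set V) (a b u : V) :
    Fin 5 :=
  if u ∈ S then 0 else if G.Adj u a ∨ G.Adj u b then 1 else
  if 2 ≤ (G.hubNeighbors S a b u).card then 2 else
  if (G.hubNeighbors S a b u).Nonempty then 3 else 4

/-- The number of sixths of an edge from class `i` to class `j` that its end of class `i` gets. -/
def classWeight (i j : Fin 5) : ℕ :=
  ![![0, 0, 0, 0, 0],
    ![6, 3, 2, 0, 0],
    ![0, 4, 3, 3, 0],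
    ![0, 6, 3, 3, 0],
    ![0, 0, 6, 6, 0]] i j

theorem classWeight_add_le : ∀ i j, classWeight i j + classWeight j i ≤ 6 := by
  decide

theorem Finset.add_le_sum_of_ne {ι : Type*} {s : Finset ι} (f : ι → ℕ) {x y : ι} (hx : x ∈ s)
    (hy : y ∈ s) (hxy : x ≠ y) : f x + f y ≤ ∑ i ∈ s, f i := by
  classical
  rw [← Finset.sum_pair hxy]
  exact Finset.sum_le_sum_of_subset (by simp [Finset.insert_subset_iff, hx, hy])

namespace SimpleGraph

variable [Fintype V] {S : Set V} {a b u x y z : V}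

theorem mem_hubNeighbors :
    y ∈ G.hubNeighbors S a b u ↔ G.Adj u y ∧ y ∉ S ∧ (G.Adj y a ∨ G.Adj y b) := by
  simp [hubNeighbors]

theorem hubNeighbors_comm : G.hubNeighbors S a b u = G.hubNeighbors S b a u := by
  ext; simp [mem_hubNeighbors, or_comm]

theorem routeClass_comm : G.routeClass S a b u = G.routeClass S b a u := by
  simp only [routeClass, hubNeighbors_comm (a := a) (b := b)]
  split_ifs <;> first | rfl | tauto

theorem routeClass_of_mem (hu : u ∈ S) : G.routeClass S a b u = 0 := by
  simp [routeClass, hu]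

theorem routeClass_of_adj (hu : u ∉ S) (h : G.Adj u a ∨ G.Adj u b) :
    G.routeClass S a b u = 1 := by
  simp [routeClass, hu, h]

theorem routeClass_of_mem_hubNeighbors (h : y ∈ G.hubNeighbors S a b u) :
    G.routeClass S a b y = 1 :=
  routeClass_of_adj (mem_hubNeighbors.1 h).2.1 (mem_hubNeighbors.1 h).2.2

theorem routeClass_eq_two (hu : u ∉ S) (h : ¬ (G.Adj u a ∨ G.Adj u b))
    (hx : x ∈ G.hubNeighbors S a b u) (hy : y ∈ G.hubNeighbors S a b u) (hxy : x ≠ y) :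
    G.routeClass S a b u = 2 := by
  have : 2 ≤ (G.hubNeighbors S a b u).card := Finset.one_lt_card.2 ⟨x, hx, y, hy, hxy⟩
  simp [routeClass, hu, h, this]

theorem routeClass_eq_two_or_three (hu : u ∉ S) (h : ¬ (G.Adj u a ∨ G.Adj u b))
    (hx : x ∈ G.hubNeighbors S a b u) :
    G.routeClass S a b u = 2 ∨ G.routeClass S a b u = 3 := by
  have : (G.hubNeighbors S a b u).Nonempty := ⟨x, hx⟩
  simp only [routeClass, hu, h, this]
  split_ifs <;> simp_all

theorem IsRouteStep.routeClass_left (h : G.IsRouteStep S a u z) :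
    z ∈ G.hubNeighbors S a b u ∨ G.routeClass S a b z = 2 ∨ G.routeClass S a b z = 3 := by
  obtain ⟨hz, huz, h⟩ := h
  by_cases hM : G.Adj z a ∨ G.Adj z b
  · exact .inl (mem_hubNeighbors.2 ⟨huz, hz, hM⟩)
  · rcases h with h | ⟨x, hx, -, hzx, hxa⟩
    · exact absurd (.inl h) hM
    · exact .inr (routeClass_eq_two_or_three hz hM (mem_hubNeighbors.2 ⟨hzx, hx, .inl hxa⟩))

theorem IsRouteStep.routeClass_right (h : G.IsRouteStep S b u z) :
    z ∈ G.hubNeighbors S a b u ∨ G.routeClass S a b z = 2 ∨ G.routeClass S a b z = 3 := by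
  rw [hubNeighbors_comm, routeClass_comm]
  exact h.routeClass_left

variable [DecidableRel G.Adj]

theorem HasRoutes.eight_le_of_adj_left (h : G.HasRoutes S a b) (ha : a ∈ S) (hb : b ∈ S)
    (hab : a ≠ b) (hu : u ∉ S) (hua : G.Adj u a) :
    8 ≤ ∑ y ∈ G.neighborFinset u, classWeight (G.routeClass S a b u) (G.routeClass S a b y) := by
  have key : ∀ y ≠ a, G.Adj u y → 2 ≤ classWeight 1 (G.routeClass S a b y) →
      8 ≤ ∑ y ∈ G.neighborFinset u,
        classWeight (G.routeClass S a b u) (G.routeClass S a b y) := by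
    intro y hy huy hw
    refine le_trans ?_ (Finset.add_le_sum_of_ne _ (x := a) (y := y) (by simpa) (by simpa) hy.symm)
    rw [routeClass_of_adj hu (.inl hua), routeClass_of_mem ha]
    simp only [classWeight] at hw ⊢
    simpa using Nat.add_le_add_left hw 6
  rcases (h u hu).2.1 with hub | ⟨z, hz, huz, h⟩
  · exact key b hab.symm hub (by rw [routeClass_of_mem hb]; decide)
  · refine key z (fun e => hz (e ▸ ha)) huz ?_
    by_cases hM : G.Adj z a ∨ G.Adj z b
    · rw [routeClass_of_adj hz hM]
      decide
    · rcases h with h | ⟨x, hx, hxu, hzx, hxb⟩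
      · exact absurd (.inr h) hM
      · rw [routeClass_eq_two hz hM (mem_hubNeighbors.2 ⟨hzx, hx, .inr hxb⟩)
          (mem_hubNeighbors.2 ⟨huz.symm, hu, .inl hua⟩) hxu]
        decide

theorem HasRoutes.eight_le (h : G.HasRoutes S a b) (ha : a ∈ S) (hb : b ∈ S)
    (hab : a ≠ b) (hu : u ∉ S) :
    8 ≤ ∑ y ∈ G.neighborFinset u, classWeight (G.routeClass S a b u) (G.routeClass S a b y) := by
  by_cases hua : G.Adj u a
  · exact h.eight_le_of_adj_left ha hb hab hu hua
  by_cases hub : G.Adj u b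
  · simp only [routeClass_comm (a := a)]
    exact h.symm.eight_le_of_adj_left hb ha hab.symm hu hub
  obtain ⟨z, z', hne, hz, hz'⟩ := (h u hu).2.2 hua hub
  have hM : ¬ (G.Adj u a ∨ G.Adj u b) := by tauto
  by_cases htwo : 1 < (G.hubNeighbors S a b u).card
  · obtain ⟨x, hx, y, hy, hxy⟩ := Finset.one_lt_card.1 htwo
    refine le_trans ?_ (Finset.add_le_sum_of_ne _ (by simpa using (mem_hubNeighbors.1 hx).1)
      (by simpa using (mem_hubNeighbors.1 hy).1) hxy)
    rw [routeClass_eq_two hu hM hx hy hxy, routeClass_of_mem_hubNeighbors hx,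
      routeClass_of_mem_hubNeighbors hy]
    decide
  by_cases hone : (G.hubNeighbors S a b u).Nonempty
  · obtain ⟨t, hut, ht⟩ : ∃ t, G.Adj u t ∧
        (G.routeClass S a b t = 2 ∨ G.routeClass S a b t = 3) := by
      rcases hz.routeClass_left (b := b) with h1 | h1
      · rcases hz'.routeClass_right (a := a) with h2 | h2
        · exact absurd (Finset.one_lt_card.2 ⟨z, h1, z', h2, hne⟩) htwo
        · exact ⟨z', hz'.2.1, h2⟩
      · exact ⟨z, hz.2.1, h1⟩
    have hu3 : G.routeClass S a b u = 3 := by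
      simp [routeClass, hu, hM, hone, Nat.succ_le_iff, htwo]
    obtain ⟨x, hx⟩ := hone
    have hx1 := routeClass_of_mem_hubNeighbors hx
    have hxt : x ≠ t := by
      rintro rfl
      simp [hx1] at ht
    refine le_trans ?_ (Finset.add_le_sum_of_ne _ (by simpa using (mem_hubNeighbors.1 hx).1)
      (by simpa using hut) hxt)
    rcases ht with ht | ht <;> rw [hu3, hx1, ht] <;> decide
  · have hu4 : G.routeClass S a b u = 4 := by
      simp [routeClass, hu, hM, hone, Nat.succ_le_iff, htwo]
    have h1 := (hz.routeClass_left (b := b)).resolve_left fun h => hone ⟨_, h⟩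
    have h2 := (hz'.routeClass_right (a := a)).resolve_left fun h => hone ⟨_, h⟩
    refine le_trans ?_ (Finset.add_le_sum_of_ne _ (by simpa using hz.2.1)
      (by simpa using hz'.2.1) hne)
    rcases h1 with h1 | h1 <;> rcases h2 with h2 | h2 <;> rw [hu4, h1, h2] <;> decide

theorem HasRoutes.four_mul_card_le {v : V} (h : G.HasRoutes {v, a, b} a b) (hab : a ≠ b) :
    4 * Fintype.card V ≤ 3 * G.edgeFinset.card + 12 := by
  classical
  set T : Finset V := {v, a, b} with hT
  have h8 := calc
    Tᶜ.card * 8 ≤ ∑ u ∈ Tᶜ, ∑ y ∈ G.neighborFinset u,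
        classWeight (G.routeClass {v, a, b} a b u) (G.routeClass {v, a, b} a b y) :=
      Finset.card_nsmul_le_sum _ _ _ fun u hu =>
        h.eight_le (by simp) (by simp) hab (by simpa [hT] using hu)
    _ ≤ ∑ u, ∑ y ∈ G.neighborFinset u,
        classWeight (G.routeClass {v, a, b} a b u) (G.routeClass {v, a, b} a b y) :=
      Finset.sum_le_sum_of_subset (Finset.subset_univ _)
    _ ≤ 6 * G.edgeFinset.card :=
      G.sum_weight_le_mul_card_edgeFinset fun x y => classWeight_add_le _ _
  have h3 : T.card ≤ 3 := Finset.card_le_three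
  rw [Finset.card_compl] at h8
  omega

end SimpleGraph

end Discharging

section Colouring

variable {V : Type*} {G : SimpleGraph V} {k : ℕ} {col : Sym2 V → Fin k}

theorem IsRainbowWalk.length_le {u v : V} {p : G.Walk u v} (h : IsRainbowWalk col p) :
    p.length ≤ k := by
  simpa using List.Nodup.length_le_card h

theorem RainbowTwoConnectedColouring.exists_paths (h : RainbowTwoConnectedColouring G col)
    (hk : k ≤ 4) {u v : V} (huv : v ≠ u) (hadj : ¬ G.Adj v u) :
    ∃ w w', w ≠ w' ∧ G.Adj v w ∧ G.Adj v w' ∧ ∃ (p : G.Walk w u) (q : G.Walk w' u),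
      p.IsPath ∧ q.IsPath ∧ p.length ≤ 3 ∧ q.length ≤ 3 ∧ v ∉ p.support ∧ v ∉ q.support ∧
      ∀ y ∈ p.support, y ∈ q.support → y = u := by
  obtain ⟨p, q, hp, hq, -, hp', hq', hd⟩ := h v u huv
  have hpl := hp'.length_le
  have hql := hq'.length_le
  match p, q with
  | .nil, _ => exact absurd rfl huv
  | _, .nil => exact absurd rfl huv
  | .cons (v := w) hw p, .cons (v := w') hw' q =>
    rw [Walk.cons_isPath_iff] at hp hq
    rw [Walk.length_cons] at hpl hql
    have hd' : ∀ y ∈ p.support, y ∈ q.support → y = u := fun y h1 h2 =>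
      (hd y (by simp [h1]) (by simp [h2])).resolve_left fun e => hp.2 (e ▸ h1)
    refine ⟨w, w', ?_, hw, hw', p, q, hp.1, hq.1, by omega, by omega, hp.2, hq.2, hd'⟩
    rintro rfl
    exact hadj (hd' w p.start_mem_support q.start_mem_support ▸ hw)

theorem RainbowTwoConnectedColouring.hasRoutes (h : RainbowTwoConnectedColouring G col)
    (hk : k ≤ 4) {v a b : V} (hv : ∀ y, G.Adj v y → y = a ∨ y = b) :
    G.HasRoutes {v, a, b} a b := by
  intro u hu
  have hu' := hu
  simp only [Set.mem_insert_iff, Set.mem_singleton_iff, not_or] at hu'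
  obtain ⟨huv, hua, hub⟩ := hu'
  obtain ⟨p, q, hp, hq, hpl, hql, hvp, hvq, hd⟩ : ∃ (p : G.Walk a u) (q : G.Walk b u),
      p.IsPath ∧ q.IsPath ∧ p.length ≤ 3 ∧ q.length ≤ 3 ∧ v ∉ p.support ∧ v ∉ q.support ∧
      ∀ y ∈ p.support, y ∈ q.support → y = u := by
    obtain ⟨w, w', hne, hw, hw', p, q, hp, hq, hpl, hql, hvp, hvq, hd⟩ :=
      h.exists_paths hk (Ne.symm huv) fun e => (hv u e).elim hua hub
    rcases hv w hw with rfl | rfl <;> rcases hv w' hw' with rfl | rfl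
    · exact absurd rfl hne
    · exact ⟨p, q, hp, hq, hpl, hql, hvp, hvq, hd⟩
    · exact ⟨q, p, hq, hp, hql, hpl, hvq, hvp, fun y h1 h2 => hd y h2 h1⟩
    · exact absurd rfl hne
  have h1 := hp.adj_or_isRouteStep (S := {v, a, b}) hpl hua (by
    rintro x hx (rfl | rfl | rfl)
    · exact absurd hx hvp
    · rfl
    · exact absurd (hd x hx q.start_mem_support).symm hub)
  have h2 := hq.adj_or_isRouteStep (S := {v, a, b}) hql hub (by
    rintro x hx (rfl | rfl | rfl)
    · exact absurd hx hvq
    · exact absurd (hd x p.start_mem_support hx).symm hua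
    · rfl)
  refine ⟨h1.imp_right fun ⟨z, hz⟩ => ⟨z, hz.2.2⟩, h2.imp_right fun ⟨z, hz⟩ => ⟨z, hz.2.2⟩,
    fun ha hb => ?_⟩
  obtain ⟨z, hz, hzu, hz'⟩ := h1.resolve_left ha
  obtain ⟨y, hy, hyu, hy'⟩ := h2.resolve_left hb
  refine ⟨z, y, ?_, hz', hy'⟩
  rintro rfl
  exact hzu (hd z hz hy)

theorem RainbowTwoConnectedColouring.four_mul_card_le [Fintype V] [DecidableRel G.Adj]
    (h : RainbowTwoConnectedColouring G col) (hk : k ≤ 4) (hV : 4 ≤ Fintype.card V) :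
    4 * Fintype.card V ≤ 3 * G.edgeFinset.card + 12 := by
  classical
  by_cases hdeg : ∀ v, 3 ≤ G.degree v
  · have := Finset.card_nsmul_le_sum Finset.univ _ 3 fun v _ => hdeg v
    rw [G.sum_degrees_eq_twice_card_edges, smul_eq_mul, Finset.card_univ] at this
    omega
  · push Not at hdeg
    obtain ⟨v, hv⟩ := hdeg
    obtain ⟨u, hu⟩ : ∃ u, u ∉ insert v (G.neighborFinset v) := by
      by_contra! hall
      have h1 := Finset.card_le_card (fun t _ => hall t : Finset.univ ⊆ _)
      have h2 := Finset.card_insert_le v (G.neighborFinset v)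
      rw [Finset.card_univ] at h1
      rw [G.card_neighborFinset_eq_degree] at h2
      omega
    simp only [Finset.mem_insert, mem_neighborFinset, not_or] at hu
    obtain ⟨a, b, hab, ha, hb, -⟩ := h.exists_paths hk (Ne.symm hu.1) hu.2
    have hN : {a, b} = G.neighborFinset v :=
      Finset.eq_of_subset_of_card_le (by simp [Finset.insert_subset_iff, ha, hb]) (by
        rw [G.card_neighborFinset_eq_degree, Finset.card_pair hab]
        omega)
    refine (h.hasRoutes hk (v := v) (a := a) (b := b) fun y hy => ?_).four_mul_card_le hab
    have : y ∈ ({a, b} : Finset V) := hN ▸ (G.mem_neighborFinset v y).2 hy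
    simpa using this

end Colouring

/-- For r ∈ {3,4} and n ≥ 18, every 2-connected graph on n vertices
with rc₂(G) ≤ r has at least (4/3)n − 24 edges; consequently t₂(n,r) ≥ (4/3)n − 24. -/
theorem stmt3 (r n : ℕ) (hr : r = 3 ∨ r = 4) (hn : 18 ≤ n) :
    (∀ G : SimpleGraph (Fin n), TwoConnected G → rc2 G ≤ r →
      (4 / 3 : ℝ) * n - 24 ≤ (G.edgeSet.ncard : ℝ)) ∧
    (4 / 3 : ℝ) * n - 24 ≤ (t2 n r : ℝ) := by
  have key : ∀ G : SimpleGraph (Fin n), TwoConnected G → rc2 G ≤ r →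
      (4 / 3 : ℝ) * n - 24 ≤ (G.edgeSet.ncard : ℝ) := by
    classical
    intro G hG hrc
    obtain ⟨col, hcol⟩ := hG.exists_colouring_of_rc2_le hrc
    have h := hcol.four_mul_card_le (by omega) (by simp; omega)
    rw [Fintype.card_fin] at h
    rw [← G.coe_edgeFinset, Set.ncard_coe_finset]
    have h' : (4 * n : ℝ) ≤ 3 * G.edgeFinset.card + 12 := by exact_mod_cast h
    linarith
  refine ⟨key, ?_⟩
  obtain ⟨G, hG, hrc, hm⟩ : t2 n r ∈ {m : ℕ | ∃ G : SimpleGraph (Fin n),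
      TwoConnected G ∧ rc2 G ≤ r ∧ G.edgeSet.ncard = m} :=
    Nat.sInf_mem ⟨_, ⊤, twoConnected_top (by simp; omega),
      (rc2_top_le (by omega)).trans (by omega), rfl⟩
  rw [← hm]
  exact key G hG hrc
end

section
/- For n ≥ 7, there exists a 2-connected graph G on n vertices with |E(G)| ≤ (7n − 19)/3 and rc₂(G) ≤ 5. Consequently t₂(n,5) ≤ (7n − 19)/3. -/
open SimpleGraph

/-- Two distinct vertices `u`, `v` joined by two internally disjoint rainbow paths. -/
def RainbowJoined {V α : Type*} (G : SimpleGraph V) (col : Sym2 V → α) (u v : V) : Prop :=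
  ∃ p q : G.Walk u v, p.IsPath ∧ q.IsPath ∧ p ≠ q ∧
    IsRainbowWalk col p ∧ IsRainbowWalk col q ∧
    ∀ w : V, w ∈ p.support → w ∈ q.support → w = u ∨ w = v

namespace RainbowJoined

variable {V W α : Type*} {G : SimpleGraph V} {H : SimpleGraph W}

theorem symm {col : Sym2 V → α} {u v : V} (h : RainbowJoined G col u v) :
    RainbowJoined G col v u := by
  obtain ⟨p, q, hp, hq, hpq, hcp, hcq, hd⟩ := h
  refine ⟨p.reverse, q.reverse, hp.reverse, hq.reverse, ?_, ?_, ?_, ?_⟩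
  · exact fun h => hpq (Walk.reverse_injective h)
  · simpa [IsRainbowWalk] using hcp
  · simpa [IsRainbowWalk] using hcq
  · intro w hwp hwq
    exact (hd w (by simpa using hwp) (by simpa using hwq)).symm

/-- An injective colour-preserving homomorphism maps joined pairs to joined pairs. -/
theorem map {col : Sym2 V → α} {col' : Sym2 W → α} {u v : V} (h : RainbowJoined G col u v)
    (f : G →g H) (hf : Function.Injective f) (hcol : ∀ e, col' (e.map f) = col e) :
    RainbowJoined H col' (f u) (f v) := by
  obtain ⟨p, q, hp, hq, hpq, hcp, hcq, hd⟩ := h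
  have hc : col' ∘ Sym2.map f = col := funext hcol
  refine ⟨p.map f, q.map f, hp.map hf,
    hq.map hf, ?_, ?_, ?_, ?_⟩
  · exact fun h => hpq (Walk.map_injective_of_injective hf u v h)
  · simpa [IsRainbowWalk, Walk.edges_map, hc] using hcp
  · simpa [IsRainbowWalk, Walk.edges_map, hc] using hcq
  · intro w hwp hwq
    simp only [Walk.support_map, List.mem_map] at hwp hwq
    obtain ⟨x, hx, rfl⟩ := hwp
    obtain ⟨y, hy, hyx⟩ := hwq
    obtain rfl := hf hyx
    exact (hd y hx hy).imp (congrArg f) (congrArg f)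

end RainbowJoined

theorem RainbowTwoConnectedColouring.twoConnected {V α : Type*} [Fintype V] {G : SimpleGraph V}
    {col : Sym2 V → α} (h : RainbowTwoConnectedColouring G col) (hV : 3 ≤ Fintype.card V) :
    TwoConnected G := by
  refine ⟨hV, fun w => ?_⟩
  have hne : Nonempty ({w}ᶜ : Set V) := by
    have : Nontrivial V := Fintype.one_lt_card_iff_nontrivial.1 (by omega)
    obtain ⟨x, hx⟩ := exists_ne w
    exact ⟨x, hx⟩
  refine (connected_iff _).2 ⟨?_, hne⟩
  rintro ⟨u, hu⟩ ⟨v, hv⟩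
  by_cases huv : u = v
  · subst huv
    exact Reachable.refl _
  have avoid : ∀ p : G.Walk u v, w ∉ p.support →
      (G.induce ({w}ᶜ : Set V)).Reachable ⟨u, hu⟩ ⟨v, hv⟩ := fun p hp =>
    ⟨p.induce _ fun x hx => by rintro rfl; exact hp hx⟩
  obtain ⟨p, q, -, -, -, -, -, hd⟩ := h u v huv
  by_cases hp : w ∈ p.support
  · refine avoid q fun hq => ?_
    rcases hd w hp hq with rfl | rfl
    · exact hu rfl
    · exact hv rfl
  · exact avoid p hp

theorem RainbowTwoConnectedColouring.rc2_le {V : Type*} {G : SimpleGraph V} {r : ℕ}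
    {col : Sym2 V → Fin r} (h : RainbowTwoConnectedColouring G col) : rc2 G ≤ r :=
  Nat.sInf_le ⟨col, h⟩

namespace HubGraph

/-- Four core vertices (of which `0` and `1` are the hubs), `a` extra vertices and `k` units of
three vertices each. -/
abbrev Vert (a k : ℕ) : Type := Fin 4 ⊕ Fin a ⊕ Fin k × Fin 3

variable {a k l : ℕ}

abbrev core (i : Fin 4) : Vert a k := Sum.inl i

abbrev extra (j : Fin a) : Vert a k := Sum.inr (Sum.inl j)

abbrev unit (i : Fin k) (p : Fin 3) : Vert a k := Sum.inr (Sum.inr (i, p))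

/-- The index type of the edges. -/
abbrev EdgeIndex (a k : ℕ) : Type := Fin 3 ⊕ Fin a × Fin 2 ⊕ Fin k × Fin 7

/-- The core is the path `0 - 3 - 2 - 1` between the hubs, each extra vertex is joined to both
hubs, and each unit carries the same seven edges. -/
def edge : EdgeIndex a k → Sym2 (Vert a k)
  | .inl i => ![s(core 1, core 2), s(core 0, core 3), s(core 2, core 3)] i
  | .inr (.inl (j, h)) => s(core (h.castLE (by decide)), extra j)
  | .inr (.inr (i, e)) =>
    ![s(core 0, unit i 0), s(core 0, unit i 1), s(core 1, unit i 1), s(core 0, unit i 2),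
      s(core 1, unit i 2), s(unit i 0, unit i 1), s(unit i 0, unit i 2)] e

def graph (a k : ℕ) : SimpleGraph (Vert a k) := fromEdgeSet (Set.range edge)

instance : DecidableRel (graph a k).Adj := fun x y =>
  decidable_of_iff ((∃ t : EdgeIndex a k, edge t = s(x, y)) ∧ x ≠ y) (by simp [graph])

theorem ncard_edgeSet_le : (graph a k).edgeSet.ncard ≤ 3 + 2 * a + 7 * k := by
  have h : (graph a k).edgeSet ⊆ Set.range edge := by simp [graph]
  calc (graph a k).edgeSet.ncard ≤ (Set.range (edge (a := a) (k := k))).ncard :=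
        Set.ncard_le_ncard h (Set.finite_range _)
    _ ≤ Nat.card (EdgeIndex a k) := by
        rw [← Set.image_univ, ← Set.ncard_univ]
        exact Set.ncard_image_le Set.finite_univ
    _ = 3 + 2 * a + 7 * k := by
        simp only [Nat.card_eq_fintype_card, Fintype.card_sum, Fintype.card_prod, Fintype.card_fin]
        ring

/-- The label of a vertex, which forgets the unit it lies in. -/
def label : Vert a k → ℕ
  | .inl i => i
  | .inr (.inl j) => 4 + j
  | .inr (.inr (_, p)) => 6 + p

/-- The colour of an edge in terms of the labels `x < y` of its ends. -/
def labelColour : ℕ → ℕ → Fin 5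
  | 1, 2 => 4
  | 0, 3 => 3
  | 2, 3 => 2
  | 0, 5 => 1
  | 1, 5 => 1
  | 1, 7 => 1
  | 0, 8 => 1
  | 6, 7 => 2
  | 6, 8 => 3
  | _, _ => 0

def colouring (e : Sym2 (Vert a k)) : Fin 5 :=
  labelColour (e.map label).inf (e.map label).sup

/-- The map on vertices induced by a map between the sets of units. -/
def unitMap (ι : Fin k → Fin l) : Vert a k → Vert a l :=
  Sum.map id (Sum.map id (Prod.map ι id))

theorem unitMap_injective {ι : Fin k → Fin l} (hι : Function.Injective ι) :
    Function.Injective (unitMap (a := a) ι) :=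
  Function.injective_id.sumMap (Function.injective_id.sumMap (hι.prodMap Function.injective_id))

theorem map_unitMap_edge (ι : Fin k → Fin l) (t : EdgeIndex a k) :
    (edge t).map (unitMap ι) = edge (Sum.map id (Sum.map id (Prod.map ι id)) t) := by
  rcases t with i | ⟨j, h⟩ | ⟨i, e⟩
  · fin_cases i <;> rfl
  · rfl
  · fin_cases e <;> rfl

theorem label_unitMap (ι : Fin k → Fin l) (x : Vert a k) : label (unitMap ι x) = label x := by
  rcases x with i | j | ⟨i, p⟩ <;> rfl

theorem colouring_map_unitMap (ι : Fin k → Fin l) (e : Sym2 (Vert a k)) :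
    colouring (e.map (unitMap ι)) = colouring e := by
  have h : label ∘ unitMap (a := a) ι = label := funext (label_unitMap ι)
  simp only [colouring, Sym2.map_map, h]

/-- An injection between the sets of units induces a graph homomorphism. -/
def unitHom {ι : Fin k → Fin l} (hι : Function.Injective ι) : graph a k →g graph a l where
  toFun := unitMap ι
  map_rel' := by
    rintro x y ⟨⟨t, ht⟩, hxy⟩
    refine ⟨⟨_, (map_unitMap_edge ι t).symm.trans ?_⟩, (unitMap_injective hι).ne hxy⟩
    rw [ht, Sym2.map_mk]

theorem rainbowJoined_unitMap {ι : Fin k → Fin l} (hι : Function.Injective ι) {u v : Vert a k}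
    (h : RainbowJoined (graph a k) colouring u v) :
    RainbowJoined (graph a l) colouring (unitMap ι u) (unitMap ι v) :=
  h.map (unitHom hι) (unitMap_injective hι) (colouring_map_unitMap ι)

/-- The walk from `u` to `v` whose internal vertices are listed in order, if there is one. -/
def walkThrough {V : Type*} {G : SimpleGraph V} [DecidableRel G.Adj] :
    (u v : V) → List V → Option (G.Walk u v)
  | u, v, [] => if h : G.Adj u v then some h.toWalk else none
  | u, v, w :: s => if h : G.Adj u w then (walkThrough w v s).map (Walk.cons h) else none

/-- Pairs of lists of internal vertices of two disjoint rainbow paths. Here `0, …, 3` are the core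
vertices, `4, 5` the extra vertices, `6, 7, 8` the first unit and `9, 10, 11` the second. -/
def routes : List (List ℕ × List ℕ) :=
  [([0], [1]), ([], [1, 2, 3]), ([0, 3, 2], []), ([0, 3], [1]), ([0], [1, 2]), ([7], [8]),
    ([0], [1, 7]), ([0, 8], []), ([1, 7], [3]), ([], [3, 0, 7]), ([], [2, 1, 7]), ([0, 7], [2]),
    ([0, 7, 1], []), ([0], [8, 1]), ([1], [6, 0]), ([0], [1, 10]), ([0, 3], [7, 1]),
    ([0], [8, 1, 2]), ([7, 1], [8, 0]), ([1], [6, 8, 0]), ([0], [6, 8, 1]), ([0], [6, 7, 1]),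
    ([0, 11], [8, 1, 10]), ([0, 11, 9], [8, 1]), ([1, 11], [6, 8, 0]), ([0, 9], [6, 7, 1]),
    ([0, 11, 9], [6, 8, 1])]

/-- The vertex with a given number in the numbering used by `routes`, if it exists. -/
def vertexOfNat (a k m : ℕ) : Option (Vert a k) :=
  if h : m < 4 then some (core ⟨m, h⟩)
  else if m < 6 then if h : m - 4 < a then some (extra ⟨m - 4, h⟩) else none
  else if h : (m - 6) / 3 < k then
    some (unit ⟨(m - 6) / 3, h⟩ ⟨m % 3, Nat.mod_lt _ (by decide)⟩)
  else none

/-- The walks `p` and `q` are internally disjoint rainbow paths. -/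
def DisjointRainbowPaths {u v : Vert a k} (p q : (graph a k).Walk u v) : Prop :=
  p.support.Nodup ∧ q.support.Nodup ∧ p.support ≠ q.support ∧
    (p.edges.map colouring).Nodup ∧ (q.edges.map colouring).Nodup ∧
    ∀ x ∈ p.support, ∀ y ∈ q.support, x ≠ y ∨ x = u ∨ x = v

set_option synthInstance.maxSize 1000 in
instance {u v : Vert a k} (p q : (graph a k).Walk u v) : Decidable (DisjointRainbowPaths p q) := by
  unfold DisjointRainbowPaths
  infer_instance

/-- Some entry of `routes` gives two disjoint rainbow paths from `u` to `v`. -/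
def Routed (u v : Vert a k) : Prop :=
  ∃ r ∈ routes,
    ∃ p ∈ (walkThrough u v (r.1.filterMap (vertexOfNat a k))).toList,
    ∃ q ∈ (walkThrough u v (r.2.filterMap (vertexOfNat a k))).toList, DisjointRainbowPaths p q

instance (u v : Vert a k) : Decidable (Routed u v) := by
  unfold Routed
  infer_instance

theorem Routed.rainbowJoined {u v : Vert a k} (h : Routed u v) :
    RainbowJoined (graph a k) colouring u v := by
  obtain ⟨-, -, p, -, q, -, hp, hq, hpq, hcp, hcq, hd⟩ := h
  exact ⟨p, q, .mk' hp, .mk' hq, fun h => hpq (congrArg _ h), hcp, hcq,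
    fun w hwp hwq => (hd w hwp w hwq).resolve_left (not_not_intro rfl)⟩

theorem rainbowJoined_of_routed {u v : Vert a k} (h : Routed u v ∨ Routed v u) :
    RainbowJoined (graph a k) colouring u v :=
  h.elim Routed.rainbowJoined fun h => h.rainbowJoined.symm

theorem routed_of_one_unit :
    ∀ (a : Fin 3) (u v : Vert a 1), u ≠ v → Routed u v ∨ Routed v u := by
  decide +kernel

theorem routed_of_two_units :
    ∀ a p q : Fin 3,
      Routed (unit 0 p : Vert a 2) (unit 1 q) ∨ Routed (unit 1 q : Vert a 2) (unit 0 p) := by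
  decide +kernel

theorem rainbowTwoConnectedColouring (ha : a < 3) (hk : 0 < k) :
    RainbowTwoConnectedColouring (graph a k) colouring := by
  have one : ∀ (i : Fin k) (u v : Vert a 1), u ≠ v →
      RainbowJoined (graph a k) colouring (unitMap (fun _ => i) u) (unitMap (fun _ => i) v) :=
    fun i u v huv => rainbowJoined_unitMap (Function.injective_of_subsingleton _) <|
      rainbowJoined_of_routed (routed_of_one_unit ⟨a, ha⟩ u v huv)
  have lift : ∀ (i : Fin k) (u : Vert a k), (∀ j p, u = unit j p → j = i) →
      ∃ u' : Vert a 1, unitMap (fun _ => i) u' = u := by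
    rintro i (x | x | ⟨j, p⟩) h
    · exact ⟨core x, rfl⟩
    · exact ⟨extra x, rfl⟩
    · obtain rfl := h j p rfl
      exact ⟨unit 0 p, rfl⟩
  have joined : ∀ (i : Fin k) (u v : Vert a k), u ≠ v → (∀ j p, u = unit j p → j = i) →
      (∀ j p, v = unit j p → j = i) → RainbowJoined (graph a k) colouring u v := by
    intro i u v huv hu hv
    obtain ⟨u, rfl⟩ := lift i u hu
    obtain ⟨v, rfl⟩ := lift i v hv
    exact one i u v fun h => huv (congrArg _ h)
  intro u v huv
  change RainbowJoined _ _ _ _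
  by_cases hu : ∃ i p, u = unit i p
  · obtain ⟨i, p, rfl⟩ := hu
    by_cases hv : ∃ j q, v = unit j q ∧ j ≠ i
    · obtain ⟨j, q, rfl, hji⟩ := hv
      have hι : Function.Injective ![i, j] := by
        intro x y
        fin_cases x <;> fin_cases y <;> simp [hji, hji.symm]
      exact rainbowJoined_unitMap hι
        (rainbowJoined_of_routed (routed_of_two_units ⟨a, ha⟩ p q))
    · push Not at hv
      exact joined i _ _ huv (by simp +contextual) hv
  · push Not at hu
    by_cases hv : ∃ j q, v = unit j q
    · obtain ⟨j, q, rfl⟩ := hv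
      exact joined j _ _ huv (fun i p h => absurd h (hu i p)) (by simp +contextual)
    · push Not at hv
      exact joined ⟨0, hk⟩ _ _ huv (fun i p h => absurd h (hu i p)) fun i p h => absurd h (hv i p)

end HubGraph

/-- The integer form of the bound: `3m ≤ 7n - 19`. -/
theorem exists_twoConnected_rc2_le_five (n : ℕ) (hn : 7 ≤ n) :
    ∃ G : SimpleGraph (Fin n), TwoConnected G ∧ 3 * G.edgeSet.ncard + 19 ≤ 7 * n ∧ rc2 G ≤ 5 := by
  obtain ⟨a, k, ha, hk, rfl⟩ : ∃ a k : ℕ, a < 3 ∧ 0 < k ∧ n = 4 + a + 3 * k :=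
    ⟨(n - 4) % 3, (n - 4) / 3, by omega, by omega, by omega⟩
  have hcard : Fintype.card (HubGraph.Vert a k) = 4 + a + 3 * k := by
    simp only [Fintype.card_sum, Fintype.card_prod, Fintype.card_fin]
    ring
  let e : HubGraph.Vert a k ≃ Fin (4 + a + 3 * k) := Fintype.equivFinOfCardEq hcard
  let G := (HubGraph.graph a k).map e.toEmbedding
  have h : RainbowTwoConnectedColouring G fun s => HubGraph.colouring (s.map e.symm) := by
    intro u v huv
    obtain ⟨u, rfl⟩ := e.surjective u
    obtain ⟨v, rfl⟩ := e.surjective v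
    have huv' := HubGraph.rainbowTwoConnectedColouring ha hk u v fun h => huv (congrArg e h)
    refine RainbowJoined.map huv' (Embedding.map e.toEmbedding _).toHom e.injective fun s => ?_
    change HubGraph.colouring ((s.map e).map e.symm) = _
    simp [Sym2.map_map]
  refine ⟨G, h.twoConnected (by rw [Fintype.card_fin]; omega), ?_, h.rc2_le⟩
  have hle : G.edgeSet.ncard ≤ (HubGraph.graph a k).edgeSet.ncard := by
    rw [edgeSet_map]
    exact Set.ncard_image_le (Set.toFinite _)
  have := HubGraph.ncard_edgeSet_le (a := a) (k := k)
  omega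

/-- For n ≥ 7 there is a 2-connected graph on n vertices with at
most (7n − 19)/3 edges and rc₂ ≤ 5; consequently t₂(n,5) ≤ (7n − 19)/3. -/
theorem stmt7 (n : ℕ) (hn : 7 ≤ n) :
    (∃ G : SimpleGraph (Fin n), TwoConnected G ∧
      (G.edgeSet.ncard : ℝ) ≤ (7 * (n : ℝ) - 19) / 3 ∧ rc2 G ≤ 5) ∧
    (t2 n 5 : ℝ) ≤ (7 * (n : ℝ) - 19) / 3 := by
  obtain ⟨G, hG, hcard, hrc⟩ := exists_twoConnected_rc2_le_five n hn
  have hle : (G.edgeSet.ncard : ℝ) ≤ (7 * (n : ℝ) - 19) / 3 := by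
    have : (3 * G.edgeSet.ncard + 19 : ℝ) ≤ 7 * n := by exact_mod_cast hcard
    linarith
  have ht : t2 n 5 ≤ G.edgeSet.ncard := Nat.sInf_le ⟨G, hG, hrc, rfl⟩
  exact ⟨⟨G, hG, hle, hrc⟩, (Nat.cast_le.2 ht).trans hle⟩
end
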